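/- arXiv:1807.00473 — 2 statements merged into one kernel-verified Lean document; each statement's English description precedes it below -/
import Mathlib

section
/- Let H = (V, E) be a connected 3-uniform hypergraph with m edges. Then τ(H) = (2m + 1)/3 holds if and only if H is a hypertree that admits a perfect matching. -/
variable {V : Type*} [Fintype V] [DecidableEq V] [Nonempty V]

/-- Two vertices are adjacent if some edge contains both. -/
def Adj (E : Finset (Finset V)) (u w : V) : Prop := ∃ e ∈ E, u ∈ e ∧ w ∈ e

/-- A hypergraph is connected if any two vertices are joined by a path
(equivalently, by a walk, i.e. a chain of adjacencies). -/
def HConnected (E : Finset (Finset V)) : Prop :=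
  ∀ u w : V, Relation.ReflTransGen (Adj E) u w

/-- A hypergraph is 3-uniform if every edge has exactly 3 vertices. -/
def Uniform3 (E : Finset (Finset V)) : Prop := ∀ e ∈ E, e.card = 3

/-- A cycle `v₁e₁v₂e₂…vₖeₖv₁` (k ≥ 2) in the hypergraph with edge set `E`:
distinct vertices, distinct edges, and `{vᵢ, vᵢ₊₁} ⊆ eᵢ` with indices mod k. -/
structure HCycle (E : Finset (Finset V)) where
  k : ℕ
  two_le : 2 ≤ k
  v : ZMod k → V
  e : ZMod k → Finset V
  v_inj : Function.Injective v
  e_inj : Function.Injective e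
  e_mem : ∀ i, e i ∈ E
  mem_left : ∀ i, v i ∈ e i
  mem_right : ∀ i, v (i + 1) ∈ e i

def HasCycle (E : Finset (Finset V)) : Prop := Nonempty (HCycle E)

/-- A hypertree is a connected acyclic hypergraph. -/
def IsHypertree (E : Finset (Finset V)) : Prop := HConnected E ∧ ¬ HasCycle E

/-- A vertex cover is a set of vertices meeting every edge. -/
def IsVertexCover (E : Finset (Finset V)) (S : Finset V) : Prop :=
  ∀ e ∈ E, ∃ x ∈ S, x ∈ e

/-- The vertex cover number τ: minimum cardinality of a vertex cover. -/
noncomputable def coverNum (E : Finset (Finset V)) : ℕ :=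
  sInf {n | ∃ S : Finset V, IsVertexCover E S ∧ S.card = n}

/-- A matching is a set of pairwise disjoint edges. -/
def IsMatching (E : Finset (Finset V)) (M : Finset (Finset V)) : Prop :=
  M ⊆ E ∧ ∀ e ∈ M, ∀ f ∈ M, e ≠ f → Disjoint e f

/-- The matching number ν: maximum cardinality of a matching. -/
noncomputable def matchNum (E : Finset (Finset V)) : ℕ :=
  sSup {n | ∃ M : Finset (Finset V), IsMatching E M ∧ M.card = n}

/-- A perfect matching is a matching covering every vertex. -/
def HasPerfectMatching (E : Finset (Finset V)) : Prop :=
  ∃ M : Finset (Finset V), IsMatching E M ∧ ∀ x : V, ∃ e ∈ M, x ∈ e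

/-- The degree of a vertex: the number of edges containing it. -/
def hdegree (E : Finset (Finset V)) (x : V) : ℕ := (E.filter fun e => x ∈ e).card

/-- The number of connected components of the hypergraph with vertex set `S`
and edge set `E`: the number of equivalence classes of vertices of `S` under
the equivalence generated by adjacency. -/
noncomputable def numComponents (S : Finset V) (E : Finset (Finset V)) : ℕ :=
  Nat.card (Quotient (Setoid.comap (Subtype.val : {x // x ∈ S} → V)
    (Relation.EqvGen.setoid (Adj E))))

/-- `C` is a connected component of the hypergraph with vertex set `S` and edge
set `E` : a nonempty subset of `S`, closed under reachability, any two of whose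
vertices are joined by a path. -/
def IsComponent (S : Finset V) (E : Finset (Finset V)) (C : Finset V) : Prop :=
  C ⊆ S ∧ C.Nonempty ∧
  (∀ x ∈ C, ∀ y ∈ S, Relation.ReflTransGen (Adj E) x y → y ∈ C) ∧
  (∀ x ∈ C, ∀ y ∈ C, Relation.ReflTransGen (Adj E) x y)

/-- A cycle is minimal if any two non-adjacent edges of it are disjoint. -/
def IsMinimalCycle {E : Finset (Finset V)} (C : HCycle E) : Prop :=
  ∀ i j : ZMod C.k, j ≠ i → j ≠ i + 1 → i ≠ j + 1 → Disjoint (C.e i) (C.e j)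

/-- Two cycles share a common vertex. -/
def ShareVertex {E : Finset (Finset V)} (C₁ C₂ : HCycle E) : Prop :=
  ∃ x : V, (∃ i, x ∈ C₁.e i) ∧ (∃ j, x ∈ C₂.e j)

set_option linter.unusedSectionVars false

/-- `RTree r T E`: `E` is the edge multiset of a 3-uniform hypertree whose vertices carry labels
in `V`, where `r` labels the root and `T` collects the labels of all other vertices. -/
inductive RTree : V → Multiset V → Multiset (Finset V) → Prop
  | leaf (r : V) : RTree r 0 0
  | graft {r r₁ r₂ : V} {T T₁ T₂ : Multiset V} {E E₁ E₂ : Multiset (Finset V)} :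
      RTree r T E → RTree r₁ T₁ E₁ → RTree r₂ T₂ E₂ →
      RTree r (T + r₁ ::ₘ T₁ + r₂ ::ₘ T₂) ({r, r₁, r₂} ::ₘ (E + E₁ + E₂))

/-- `S` meets every member of `E`. -/
def Covers (E : Multiset (Finset V)) (S : Finset V) : Prop := ∀ e ∈ E, ∃ x ∈ S, x ∈ e

/-- Distinct labels, a perfect matching, and small covers through every vertex. -/
def Tight (r : V) (T : Multiset V) (E : Multiset (Finset V)) : Prop :=
  (r ::ₘ T).Nodup ∧
  (∃ M : Finset (Finset V), (∀ e ∈ M, e ∈ E) ∧ 3 * M.card ≤ T.card + 1 ∧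
    ∀ x ∈ r ::ₘ T, ∃ e ∈ M, x ∈ e) ∧
  ∀ u ∈ r ::ₘ T, ∃ S, Covers E S ∧ u ∈ S ∧ 3 * S.card ≤ T.card + 1

/-- Distinct labels, a matching of all vertices but the root, and small covers through every
vertex other than the root. -/
def NearTight (r : V) (T : Multiset V) (E : Multiset (Finset V)) : Prop :=
  (r ::ₘ T).Nodup ∧
  (∃ M : Finset (Finset V), (∀ e ∈ M, e ∈ E) ∧ 3 * M.card ≤ T.card ∧
    ∀ x ∈ T, ∃ e ∈ M, x ∈ e) ∧
  (∃ S, Covers E S ∧ 3 * S.card ≤ T.card) ∧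
  ∀ u ∈ T, ∃ S, Covers E S ∧ u ∈ S ∧ 3 * S.card ≤ T.card

/-- There are covers smaller than those of tight and nearly tight trees. -/
def Loose (r : V) (T : Multiset V) (E : Multiset (Finset V)) : Prop :=
  ((∃ S, Covers E S ∧ 3 * S.card + 1 ≤ T.card) ∧
    ∃ S, Covers E S ∧ r ∈ S ∧ 3 * S.card ≤ T.card + 2) ∨
  ∃ S, Covers E S ∧ r ∈ S ∧ 3 * S.card ≤ T.card

theorem mem_cons_graft {x r r₁ r₂ : V} {T T₁ T₂ : Multiset V} :
    x ∈ r ::ₘ (T + r₁ ::ₘ T₁ + r₂ ::ₘ T₂) ↔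
      x ∈ r ::ₘ T ∨ x ∈ r₁ ::ₘ T₁ ∨ x ∈ r₂ ::ₘ T₂ := by
  simp only [Multiset.mem_cons, Multiset.mem_add, or_assoc]

theorem RTree.attach {r : V} {T : Multiset V} {E : Multiset (Finset V)} (h : RTree r T E)
    {p : V} (hp : p ∈ r ::ₘ T) (x y : V) :
    RTree r (x ::ₘ y ::ₘ T) ({p, x, y} ::ₘ E) := by
  induction h with
  | leaf r =>
    obtain rfl : p = r := by simpa using hp
    simpa using (RTree.leaf p).graft (RTree.leaf x) (RTree.leaf y)
  | @graft r r₁ r₂ T T₁ T₂ E E₁ E₂ h h₁ h₂ ih ih₁ ih₂ =>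
    rcases mem_cons_graft.1 hp with hp | hp | hp
    · convert (ih hp).graft h₁ h₂ using 1 <;> simp only [← Multiset.singleton_add] <;> abel
    · convert h.graft (ih₁ hp) h₂ using 1 <;> simp only [← Multiset.singleton_add] <;> abel
    · convert h.graft h₁ (ih₂ hp) using 1 <;> simp only [← Multiset.singleton_add] <;> abel

theorem RTree.mem_of_mem_edge {r : V} {T : Multiset V} {E : Multiset (Finset V)}
    (h : RTree r T E) {e : Finset V} (he : e ∈ E) {x : V} (hx : x ∈ e) : x ∈ r ::ₘ T := by
  induction h with
  | leaf r => simp at he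
  | graft h h₁ h₂ ih ih₁ ih₂ =>
    rw [mem_cons_graft]
    simp only [Multiset.mem_cons (a := e), Multiset.mem_add] at he
    rcases he with rfl | (he | he) | he
    · simp only [Finset.mem_insert, Finset.mem_singleton] at hx
      rcases hx with rfl | rfl | rfl <;> simp
    · exact .inl (ih he)
    · exact .inr (.inl (ih₁ he))
    · exact .inr (.inr (ih₂ he))

theorem RTree.card_eq {r : V} {T : Multiset V} {E : Multiset (Finset V)}
    (h : RTree r T E) : T.card = 2 * E.card := by
  induction h with
  | leaf r => simp
  | graft h h₁ h₂ ih ih₁ ih₂ => simp [ih, ih₁, ih₂]; ring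

theorem Adj.symm {E : Finset (Finset V)} {u w : V} (h : Adj E u w) : Adj E w u := by
  obtain ⟨e, he, hu, hw⟩ := h
  exact ⟨e, he, hw, hu⟩

theorem reflTransGen_adj_symm {E : Finset (Finset V)} {u w : V}
    (h : Relation.ReflTransGen (Adj E) u w) : Relation.ReflTransGen (Adj E) w u := by
  induction h with
  | refl => exact .refl
  | tail _ h ih => exact .head h.symm ih

theorem RTree.reachable {r : V} {T : Multiset V} {E : Multiset (Finset V)}
    (h : RTree r T E) {F : Finset (Finset V)} (hF : ∀ e ∈ E, e ∈ F) {x : V}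
    (hx : x ∈ r ::ₘ T) : Relation.ReflTransGen (Adj F) r x := by
  induction h with
  | leaf r =>
    obtain rfl : x = r := by simpa using hx
    exact .refl
  | @graft r r₁ r₂ T T₁ T₂ E E₁ E₂ h h₁ h₂ ih ih₁ ih₂ =>
    have he := hF _ (Multiset.mem_cons_self _ _)
    have a₁ : Adj F r r₁ := ⟨_, he, by simp, by simp⟩
    have a₂ : Adj F r r₂ := ⟨_, he, by simp, by simp⟩
    have ih := ih fun e he => hF e (by simp [he])
    have ih₁ := ih₁ fun e he => hF e (by simp [he])
    have ih₂ := ih₂ fun e he => hF e (by simp [he])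
    rcases mem_cons_graft.1 hx with hx | hx | hx
    · exact ih hx
    · exact .head a₁ (ih₁ hx)
    · exact .head a₂ (ih₂ hx)

theorem Covers.graft {E E₁ E₂ : Multiset (Finset V)} {S S₁ S₂ e : Finset V}
    (h : Covers E S) (h₁ : Covers E₁ S₁) (h₂ : Covers E₂ S₂)
    (he : ∃ x ∈ S ∪ S₁ ∪ S₂, x ∈ e) : Covers (e ::ₘ (E + E₁ + E₂)) (S ∪ S₁ ∪ S₂) := by
  intro f hf
  simp only [Multiset.mem_cons, Multiset.mem_add] at hf
  rcases hf with rfl | (hf | hf) | hf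
  · exact he
  · obtain ⟨x, hx, hxf⟩ := h f hf
    exact ⟨x, by simp [hx], hxf⟩
  · obtain ⟨x, hx, hxf⟩ := h₁ f hf
    exact ⟨x, by simp [hx], hxf⟩
  · obtain ⟨x, hx, hxf⟩ := h₂ f hf
    exact ⟨x, by simp [hx], hxf⟩

theorem Covers.mono {E : Multiset (Finset V)} {S S' : Finset V} (h : Covers E S)
    (hS : S ⊆ S') : Covers E S' := fun e he =>
  let ⟨x, hx, hxe⟩ := h e he
  ⟨x, hS hx, hxe⟩

theorem card_union_three_le (S S₁ S₂ : Finset V) :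
    (S ∪ S₁ ∪ S₂).card ≤ S.card + S₁.card + S₂.card := by
  have := Finset.card_union_le (S ∪ S₁) S₂
  have := Finset.card_union_le S S₁
  omega

theorem card_union_three_lt {S S₁ S₂ : Finset V} {u : V}
    (h : u ∈ S ∧ u ∈ S₁ ∨ u ∈ S ∧ u ∈ S₂ ∨ u ∈ S₁ ∧ u ∈ S₂) :
    (S ∪ S₁ ∪ S₂).card < S.card + S₁.card + S₂.card := by
  have h₁ := Finset.card_union_add_card_inter (S ∪ S₁) S₂
  have h₂ := Finset.card_union_add_card_inter S S₁
  have : 0 < ((S ∪ S₁) ∩ S₂).card ∨ 0 < (S ∩ S₁).card := by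
    simp only [Finset.card_pos]
    rcases h with h | h | h
    · exact .inr ⟨u, by simp [h]⟩
    · exact .inl ⟨u, by simp [h]⟩
    · exact .inl ⟨u, by simp [h]⟩
  omega

theorem Covers.exists_insert {E : Multiset (Finset V)} {S : Finset V} (h : Covers E S) (r : V) :
    ∃ S', Covers E S' ∧ r ∈ S' ∧ S ⊆ S' ∧ S'.card ≤ S.card + 1 :=
  ⟨insert r S, h.mono (Finset.subset_insert _ _), by simp, Finset.subset_insert _ _,
    Finset.card_insert_le _ _⟩

theorem card_graft (r₁ r₂ : V) (T T₁ T₂ : Multiset V) :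
    (T + r₁ ::ₘ T₁ + r₂ ::ₘ T₂).card = T.card + T₁.card + T₂.card + 2 := by
  simp only [Multiset.card_add, Multiset.card_cons]
  ring

/-- Covers of the three pieces, each given in a plain version and one through the root,
combine to covers of the grafted tree. -/
theorem exists_covers_graft {E E₁ E₂ : Multiset (Finset V)} {r r₁ r₂ : V}
    {S S' S₁ S₁' S₂ S₂' : Finset V}
    (h : Covers E S) (h' : Covers E S') (hr : r ∈ S')
    (h₁ : Covers E₁ S₁) (h₁' : Covers E₁ S₁') (hr₁ : r₁ ∈ S₁')
    (h₂ : Covers E₂ S₂) (h₂' : Covers E₂ S₂') (hr₂ : r₂ ∈ S₂') :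
    (∃ Q, Covers ({r, r₁, r₂} ::ₘ (E + E₁ + E₂)) Q ∧ r ∈ Q ∧
      Q.card ≤ S'.card + S₁.card + S₂.card) ∧
    (∃ Q, Covers ({r, r₁, r₂} ::ₘ (E + E₁ + E₂)) Q ∧ Q.card ≤ S.card + S₁'.card + S₂.card) ∧
    ∃ Q, Covers ({r, r₁, r₂} ::ₘ (E + E₁ + E₂)) Q ∧ Q.card ≤ S.card + S₁.card + S₂'.card :=
  ⟨⟨_, h'.graft h₁ h₂ ⟨r, by simp [hr], by simp⟩, by simp [hr], card_union_three_le ..⟩,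
    ⟨_, h.graft h₁' h₂ ⟨r₁, by simp [hr₁], by simp⟩, card_union_three_le ..⟩,
    ⟨_, h.graft h₁ h₂' ⟨r₂, by simp [hr₂], by simp⟩, card_union_three_le ..⟩⟩

theorem Tight.exists_covers {r : V} {T : Multiset V} {E : Multiset (Finset V)}
    (h : Tight r T E) :
    ∃ S S', Covers E S ∧ Covers E S' ∧ r ∈ S' ∧ 3 * S.card ≤ T.card + 1 ∧
      3 * S'.card ≤ T.card + 1 := by
  obtain ⟨S, hS, hr, hc⟩ := h.2.2 r (by simp)
  exact ⟨S, S, hS, hS, hr, hc, hc⟩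

theorem NearTight.exists_covers {r : V} {T : Multiset V} {E : Multiset (Finset V)}
    (h : NearTight r T E) :
    ∃ S S', Covers E S ∧ Covers E S' ∧ r ∈ S' ∧ 3 * S.card ≤ T.card ∧
      3 * S'.card ≤ T.card + 3 := by
  obtain ⟨S, hS, hc⟩ := h.2.2.1
  obtain ⟨S', hS', hr, -, hc'⟩ := hS.exists_insert r
  exact ⟨S, S', hS, hS', hr, hc, by omega⟩

theorem Loose.exists_covers {r : V} {T : Multiset V} {E : Multiset (Finset V)}
    (h : Loose r T E) :
    ∃ S S', Covers E S ∧ Covers E S' ∧ r ∈ S' ∧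
      (3 * S.card + 1 ≤ T.card ∧ 3 * S'.card ≤ T.card + 2 ∨
        3 * S.card ≤ T.card ∧ 3 * S'.card ≤ T.card) := by
  rcases h with ⟨⟨S, hS, hc⟩, S', hS', hr, hc'⟩ | ⟨S, hS, hr, hc⟩
  · exact ⟨S, S', hS, hS', hr, .inl ⟨hc, hc'⟩⟩
  · exact ⟨S, S, hS, hS, hr, .inr ⟨hc, hc⟩⟩

theorem Loose.of_card_le {r : V} {T : Multiset V} {E : Multiset (Finset V)} {S : Finset V}
    (hS : Covers E S) (hc : 3 * S.card + 2 ≤ T.card) : Loose r T E := by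
  obtain ⟨S', hS', hr, -, hc'⟩ := hS.exists_insert r
  exact .inl ⟨⟨S, hS, by omega⟩, S', hS', hr, by omega⟩

theorem loose_graft {r r₁ r₂ : V} {T T₁ T₂ : Multiset V} {E E₁ E₂ : Multiset (Finset V)}
    {S S' S₁ S₁' S₂ S₂' : Finset V}
    (h : Covers E S) (h' : Covers E S') (hr : r ∈ S')
    (h₁ : Covers E₁ S₁) (h₁' : Covers E₁ S₁') (hr₁ : r₁ ∈ S₁')
    (h₂ : Covers E₂ S₂) (h₂' : Covers E₂ S₂') (hr₂ : r₂ ∈ S₂')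
    (hc : 3 * (S'.card + S₁.card + S₂.card) ≤ T.card + T₁.card + T₂.card + 2 ∨
      3 * (S'.card + S₁.card + S₂.card) ≤ T.card + T₁.card + T₂.card + 4 ∧
      (3 * (S.card + S₁'.card + S₂.card) ≤ T.card + T₁.card + T₂.card + 1 ∨
        3 * (S.card + S₁.card + S₂'.card) ≤ T.card + T₁.card + T₂.card + 1)) :
    Loose r (T + r₁ ::ₘ T₁ + r₂ ::ₘ T₂) ({r, r₁, r₂} ::ₘ (E + E₁ + E₂)) := by
  obtain ⟨⟨A, hA, hrA, hcA⟩, ⟨B, hB, hcB⟩, C, hC, hcC⟩ :=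
    exists_covers_graft h h' hr h₁ h₁' hr₁ h₂ h₂' hr₂
  have hcard := card_graft r₁ r₂ T T₁ T₂
  rcases hc with hc | ⟨hc, hc' | hc'⟩
  · exact .inr ⟨A, hA, hrA, by omega⟩
  · exact .inl ⟨⟨B, hB, by omega⟩, A, hA, hrA, by omega⟩
  · exact .inl ⟨⟨C, hC, by omega⟩, A, hA, hrA, by omega⟩

/-- Grafting produces a loose tree except for three combinations of tight and nearly tight
pieces. -/
theorem loose_graft_or {r r₁ r₂ : V} {T T₁ T₂ : Multiset V} {E E₁ E₂ : Multiset (Finset V)}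
    (h : Tight r T E ∨ NearTight r T E ∨ Loose r T E)
    (h₁ : Tight r₁ T₁ E₁ ∨ NearTight r₁ T₁ E₁ ∨ Loose r₁ T₁ E₁)
    (h₂ : Tight r₂ T₂ E₂ ∨ NearTight r₂ T₂ E₂ ∨ Loose r₂ T₂ E₂) :
    Loose r (T + r₁ ::ₘ T₁ + r₂ ::ₘ T₂) ({r, r₁, r₂} ::ₘ (E + E₁ + E₂)) ∨
    (Tight r T E ∧ Tight r₁ T₁ E₁ ∧ Tight r₂ T₂ E₂) ∨
    (NearTight r T E ∧ NearTight r₁ T₁ E₁ ∧ NearTight r₂ T₂ E₂) ∨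
    (NearTight r T E ∧ Tight r₁ T₁ E₁ ∧ Tight r₂ T₂ E₂) := by
  rcases h with h | h | h <;> rcases h₁ with h₁ | h₁ | h₁ <;> rcases h₂ with h₂ | h₂ | h₂ <;>
  first
  | exact .inr (.inl ⟨h, h₁, h₂⟩)
  | exact .inr (.inr (.inl ⟨h, h₁, h₂⟩))
  | exact .inr (.inr (.inr ⟨h, h₁, h₂⟩))
  | (left
     obtain ⟨S, S', hS, hS', hr, hc⟩ := h.exists_covers
     obtain ⟨S₁, S₁', hS₁, hS₁', hr₁, hc₁⟩ := h₁.exists_covers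
     obtain ⟨S₂, S₂', hS₂, hS₂', hr₂, hc₂⟩ := h₂.exists_covers
     exact loose_graft hS hS' hr hS₁ hS₁' hr₁ hS₂ hS₂' hr₂ (by omega))

theorem nodup_graft_or {r r₁ r₂ : V} {T T₁ T₂ : Multiset V} (h : (r ::ₘ T).Nodup)
    (h₁ : (r₁ ::ₘ T₁).Nodup) (h₂ : (r₂ ::ₘ T₂).Nodup) :
    (r ::ₘ (T + r₁ ::ₘ T₁ + r₂ ::ₘ T₂)).Nodup ∨
    ∃ u, (u ∈ r ::ₘ T ∧ u ∈ r₁ ::ₘ T₁) ∨ (u ∈ r ::ₘ T ∧ u ∈ r₂ ::ₘ T₂) ∨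
      (u ∈ r₁ ::ₘ T₁ ∧ u ∈ r₂ ::ₘ T₂) := by
  by_cases hd : ∃ u, (u ∈ r ::ₘ T ∧ u ∈ r₁ ::ₘ T₁) ∨ (u ∈ r ::ₘ T ∧ u ∈ r₂ ::ₘ T₂) ∨
      (u ∈ r₁ ::ₘ T₁ ∧ u ∈ r₂ ::ₘ T₂)
  · exact .inr hd
  · left
    push Not at hd
    rw [← Multiset.cons_add, ← Multiset.cons_add, Multiset.nodup_add, Multiset.nodup_add]
    refine ⟨⟨h, h₁, Multiset.disjoint_left.2 fun {u} hu => (hd u).1 hu⟩, h₂,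
      Multiset.disjoint_left.2 fun {u} hu => ?_⟩
    rcases Multiset.mem_add.1 hu with hu | hu
    · exact (hd u).2.1 hu
    · exact (hd u).2.2 hu

theorem graft_tight {r r₁ r₂ : V} {T T₁ T₂ : Multiset V} {E E₁ E₂ : Multiset (Finset V)}
    (h : Tight r T E) (h₁ : Tight r₁ T₁ E₁) (h₂ : Tight r₂ T₂ E₂) :
    Tight r (T + r₁ ::ₘ T₁ + r₂ ::ₘ T₂) ({r, r₁, r₂} ::ₘ (E + E₁ + E₂)) ∨
    Loose r (T + r₁ ::ₘ T₁ + r₂ ::ₘ T₂) ({r, r₁, r₂} ::ₘ (E + E₁ + E₂)) := by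
  obtain ⟨hn, ⟨M, hM, hMc, hMv⟩, hS⟩ := h
  obtain ⟨hn₁, ⟨M₁, hM₁, hMc₁, hMv₁⟩, hS₁⟩ := h₁
  obtain ⟨hn₂, ⟨M₂, hM₂, hMc₂, hMv₂⟩, hS₂⟩ := h₂
  have hcard := card_graft r₁ r₂ T T₁ T₂
  have hroot := Multiset.mem_cons_self r T
  have hroot₁ := Multiset.mem_cons_self r₁ T₁
  have hroot₂ := Multiset.mem_cons_self r₂ T₂
  rcases nodup_graft_or hn hn₁ hn₂ with hN | ⟨u, hu⟩
  · refine .inl ⟨hN, ⟨M ∪ M₁ ∪ M₂, ?_, ?_, ?_⟩, ?_⟩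
    · intro e he
      simp only [Finset.mem_union] at he
      simp only [Multiset.mem_cons, Multiset.mem_add]
      rcases he with (he | he) | he
      · simp [hM e he]
      · simp [hM₁ e he]
      · simp [hM₂ e he]
    · have := card_union_three_le M M₁ M₂
      omega
    · intro x hx
      rcases mem_cons_graft.1 hx with hx | hx | hx
      · obtain ⟨e, he, hxe⟩ := hMv x hx
        exact ⟨e, by simp [he], hxe⟩
      · obtain ⟨e, he, hxe⟩ := hMv₁ x hx
        exact ⟨e, by simp [he], hxe⟩
      · obtain ⟨e, he, hxe⟩ := hMv₂ x hx
        exact ⟨e, by simp [he], hxe⟩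
    · intro u hu
      have key : ∃ a ∈ r ::ₘ T, ∃ b ∈ r₁ ::ₘ T₁, ∃ c ∈ r₂ ::ₘ T₂,
          (u = a ∨ u = b ∨ u = c) ∧ (r = a ∨ r₁ = b) := by
        rcases mem_cons_graft.1 hu with hu | hu | hu
        · exact ⟨u, hu, r₁, hroot₁, r₂, hroot₂, by simp⟩
        · exact ⟨r, hroot, u, hu, r₂, hroot₂, by simp⟩
        · exact ⟨r, hroot, r₁, hroot₁, u, hu, by simp⟩
      obtain ⟨a, ha, b, hb, c, hc, hu, he⟩ := key
      obtain ⟨S, hS, ha, hSc⟩ := hS a ha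
      obtain ⟨S₁, hS₁, hb, hSc₁⟩ := hS₁ b hb
      obtain ⟨S₂, hS₂, hc, hSc₂⟩ := hS₂ c hc
      have := card_union_three_le S S₁ S₂
      refine ⟨_, hS.graft hS₁ hS₂ ?_, ?_, by omega⟩
      · rcases he with rfl | rfl
        · exact ⟨r, by simp [ha], by simp⟩
        · exact ⟨r₁, by simp [hb], by simp⟩
      · rcases hu with rfl | rfl | rfl <;> simp [*]
  · right
    have key : ∃ a ∈ r ::ₘ T, ∃ b ∈ r₁ ::ₘ T₁, ∃ c ∈ r₂ ::ₘ T₂,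
        (u = a ∧ u = b ∨ u = a ∧ u = c ∨ u = b ∧ u = c) ∧ (r = a ∨ r₁ = b ∨ r₂ = c) := by
      rcases hu with ⟨hu, hu'⟩ | ⟨hu, hu'⟩ | ⟨hu, hu'⟩
      · exact ⟨u, hu, u, hu', r₂, hroot₂, by simp⟩
      · exact ⟨u, hu, r₁, hroot₁, u, hu', by simp⟩
      · exact ⟨r, hroot, u, hu, u, hu', by simp⟩
    obtain ⟨a, ha, b, hb, c, hc, hu, he⟩ := key
    obtain ⟨S, hS, ha, hSc⟩ := hS a ha
    obtain ⟨S₁, hS₁, hb, hSc₁⟩ := hS₁ b hb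
    obtain ⟨S₂, hS₂, hc, hSc₂⟩ := hS₂ c hc
    have : (S ∪ S₁ ∪ S₂).card < S.card + S₁.card + S₂.card := by
      refine card_union_three_lt (u := u) ?_
      rcases hu with ⟨rfl, rfl⟩ | ⟨rfl, rfl⟩ | ⟨rfl, rfl⟩ <;> simp [*]
    refine Loose.of_card_le (hS.graft hS₁ hS₂ ?_) (by omega)
    rcases he with rfl | rfl | rfl
    · exact ⟨r, by simp [ha], by simp⟩
    · exact ⟨r₁, by simp [hb], by simp⟩
    · exact ⟨r₂, by simp [hc], by simp⟩

theorem graft_nearTight_tight {r r₁ r₂ : V} {T T₁ T₂ : Multiset V}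
    {E E₁ E₂ : Multiset (Finset V)}
    (h : NearTight r T E) (h₁ : Tight r₁ T₁ E₁) (h₂ : Tight r₂ T₂ E₂) :
    NearTight r (T + r₁ ::ₘ T₁ + r₂ ::ₘ T₂) ({r, r₁, r₂} ::ₘ (E + E₁ + E₂)) ∨
    Loose r (T + r₁ ::ₘ T₁ + r₂ ::ₘ T₂) ({r, r₁, r₂} ::ₘ (E + E₁ + E₂)) := by
  obtain ⟨hn, ⟨M, hM, hMc, hMv⟩, ⟨Q, hQ, hQc⟩, hS⟩ := h
  obtain ⟨hn₁, ⟨M₁, hM₁, hMc₁, hMv₁⟩, hS₁⟩ := h₁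
  obtain ⟨hn₂, ⟨M₂, hM₂, hMc₂, hMv₂⟩, hS₂⟩ := h₂
  have hcard := card_graft r₁ r₂ T T₁ T₂
  obtain ⟨R₁, hR₁, hr₁, hRc₁⟩ := hS₁ r₁ (Multiset.mem_cons_self _ _)
  obtain ⟨R₂, hR₂, hr₂, hRc₂⟩ := hS₂ r₂ (Multiset.mem_cons_self _ _)
  rcases nodup_graft_or hn hn₁ hn₂ with hN | ⟨u, ⟨hu, hu'⟩ | ⟨hu, hu'⟩ | ⟨hu, hu'⟩⟩
  · refine .inl ⟨hN, ⟨M ∪ M₁ ∪ M₂, ?_, ?_, ?_⟩, ⟨_, hQ.graft hR₁ hR₂ ?_, ?_⟩, ?_⟩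
    · intro e he
      simp only [Finset.mem_union] at he
      simp only [Multiset.mem_cons, Multiset.mem_add]
      rcases he with (he | he) | he
      · simp [hM e he]
      · simp [hM₁ e he]
      · simp [hM₂ e he]
    · have := card_union_three_le M M₁ M₂
      omega
    · intro x hx
      rw [Multiset.mem_add, Multiset.mem_add] at hx
      rcases hx with (hx | hx) | hx
      · obtain ⟨e, he, hxe⟩ := hMv x hx
        exact ⟨e, by simp [he], hxe⟩
      · obtain ⟨e, he, hxe⟩ := hMv₁ x hx
        exact ⟨e, by simp [he], hxe⟩
      · obtain ⟨e, he, hxe⟩ := hMv₂ x hx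
        exact ⟨e, by simp [he], hxe⟩
    · exact ⟨r₁, by simp [hr₁], by simp⟩
    · have := card_union_three_le Q R₁ R₂
      omega
    · intro u hu
      rw [Multiset.mem_add, Multiset.mem_add] at hu
      rcases hu with (hu | hu) | hu
      · obtain ⟨S, hS, hu, hSc⟩ := hS u hu
        have := card_union_three_le S R₁ R₂
        exact ⟨_, hS.graft hR₁ hR₂ ⟨r₁, by simp [hr₁], by simp⟩, by simp [hu], by omega⟩
      · obtain ⟨S, hS, hu, hSc⟩ := hS₁ u hu
        have := card_union_three_le Q S R₂
        exact ⟨_, hQ.graft hS hR₂ ⟨r₂, by simp [hr₂], by simp⟩, by simp [hu], by omega⟩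
      · obtain ⟨S, hS, hu, hSc⟩ := hS₂ u hu
        have := card_union_three_le Q R₁ S
        exact ⟨_, hQ.graft hR₁ hS ⟨r₁, by simp [hr₁], by simp⟩, by simp [hu], by omega⟩
  · right
    obtain ⟨S₁, hS₁, hu₁, hSc₁⟩ := hS₁ u hu'
    rcases Multiset.mem_cons.1 hu with rfl | hu
    · have := card_union_three_le Q S₁ R₂
      exact .inr ⟨_, hQ.graft hS₁ hR₂ ⟨u, by simp [hu₁], by simp⟩, by simp [hu₁], by omega⟩
    · obtain ⟨S, hS, hu, hSc⟩ := hS u hu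
      have := card_union_three_lt (S := S) (S₁ := S₁) (S₂ := R₂) (u := u) (by simp [*])
      exact Loose.of_card_le (hS.graft hS₁ hR₂ ⟨r₂, by simp [hr₂], by simp⟩) (by omega)
  · right
    obtain ⟨S₂, hS₂, hu₂, hSc₂⟩ := hS₂ u hu'
    rcases Multiset.mem_cons.1 hu with rfl | hu
    · have := card_union_three_le Q R₁ S₂
      exact .inr ⟨_, hQ.graft hR₁ hS₂ ⟨u, by simp [hu₂], by simp⟩, by simp [hu₂], by omega⟩
    · obtain ⟨S, hS, hu, hSc⟩ := hS u hu
      have := card_union_three_lt (S := S) (S₁ := R₁) (S₂ := S₂) (u := u) (by simp [*])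
      exact Loose.of_card_le (hS.graft hR₁ hS₂ ⟨r₁, by simp [hr₁], by simp⟩) (by omega)
  · right
    obtain ⟨S₁, hS₁, hu₁, hSc₁⟩ := hS₁ u hu
    obtain ⟨S₂, hS₂, hu₂, hSc₂⟩ := hS₂ u hu'
    obtain ⟨S, hS, hr, -, hSc⟩ := hQ.exists_insert r
    have := card_union_three_lt (S := S) (S₁ := S₁) (S₂ := S₂) (u := u) (by simp [*])
    exact .inr ⟨_, hS.graft hS₁ hS₂ ⟨r, by simp [hr], by simp⟩, by simp [hr], by omega⟩

theorem graft_nearTight {r r₁ r₂ : V} {T T₁ T₂ : Multiset V} {E E₁ E₂ : Multiset (Finset V)}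
    (h : NearTight r T E) (h₁ : NearTight r₁ T₁ E₁) (h₂ : NearTight r₂ T₂ E₂)
    (hc : ({r, r₁, r₂} : Finset V).card = 3) :
    Tight r (T + r₁ ::ₘ T₁ + r₂ ::ₘ T₂) ({r, r₁, r₂} ::ₘ (E + E₁ + E₂)) ∨
    Loose r (T + r₁ ::ₘ T₁ + r₂ ::ₘ T₂) ({r, r₁, r₂} ::ₘ (E + E₁ + E₂)) := by
  have hne : r ≠ r₁ ∧ r ≠ r₂ ∧ r₁ ≠ r₂ := by
    refine ⟨?_, ?_, ?_⟩ <;> rintro rfl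
    · have := Finset.card_le_two (a := r) (b := r₂)
      simp at hc; omega
    · have := Finset.card_le_two (a := r) (b := r₁)
      rw [Finset.pair_comm r₁, Finset.insert_idem] at hc; omega
    · have := Finset.card_le_two (a := r) (b := r₁)
      simp at hc; omega
  obtain ⟨hn, ⟨M, hM, hMc, hMv⟩, ⟨Q, hQ, hQc⟩, hS⟩ := h
  obtain ⟨hn₁, ⟨M₁, hM₁, hMc₁, hMv₁⟩, ⟨Q₁, hQ₁, hQc₁⟩, hS₁⟩ := h₁
  obtain ⟨hn₂, ⟨M₂, hM₂, hMc₂, hMv₂⟩, ⟨Q₂, hQ₂, hQc₂⟩, hS₂⟩ := h₂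
  have hcard := card_graft r₁ r₂ T T₁ T₂
  rcases nodup_graft_or hn hn₁ hn₂ with hN | ⟨u, hu⟩
  · refine .inl ⟨hN, ⟨insert {r, r₁, r₂} (M ∪ M₁ ∪ M₂), ?_, ?_, ?_⟩, ?_⟩
    · intro e he
      simp only [Finset.mem_insert, Finset.mem_union] at he
      simp only [Multiset.mem_cons, Multiset.mem_add]
      rcases he with rfl | (he | he) | he
      · simp
      · simp [hM e he]
      · simp [hM₁ e he]
      · simp [hM₂ e he]
    · have := card_union_three_le M M₁ M₂
      have := Finset.card_insert_le ({r, r₁, r₂} : Finset V) (M ∪ M₁ ∪ M₂)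
      omega
    · intro x hx
      rw [mem_cons_graft] at hx
      simp only [Multiset.mem_cons] at hx
      rcases hx with (rfl | hx) | (rfl | hx) | (rfl | hx)
      · exact ⟨_, Finset.mem_insert_self _ _, by simp⟩
      · obtain ⟨e, he, hxe⟩ := hMv x hx
        exact ⟨e, by simp [he], hxe⟩
      · exact ⟨_, Finset.mem_insert_self _ _, by simp⟩
      · obtain ⟨e, he, hxe⟩ := hMv₁ x hx
        exact ⟨e, by simp [he], hxe⟩
      · exact ⟨_, Finset.mem_insert_self _ _, by simp⟩
      · obtain ⟨e, he, hxe⟩ := hMv₂ x hx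
        exact ⟨e, by simp [he], hxe⟩
    · intro u hu
      rw [mem_cons_graft] at hu
      simp only [Multiset.mem_cons] at hu
      have key : ∃ S S₁ S₂, Covers E S ∧ Covers E₁ S₁ ∧ Covers E₂ S₂ ∧
          (u ∈ S ∪ S₁ ∪ S₂ ∨ u = r ∨ u = r₁ ∨ u = r₂) ∧
          3 * (S.card + S₁.card + S₂.card) ≤ T.card + T₁.card + T₂.card := by
        rcases hu with (rfl | hu) | (rfl | hu) | (rfl | hu)
        · exact ⟨Q, Q₁, Q₂, hQ, hQ₁, hQ₂, by simp, by omega⟩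
        · obtain ⟨S, hS, hu, hSc⟩ := hS u hu
          exact ⟨S, Q₁, Q₂, hS, hQ₁, hQ₂, by simp [hu], by omega⟩
        · exact ⟨Q, Q₁, Q₂, hQ, hQ₁, hQ₂, by simp, by omega⟩
        · obtain ⟨S, hS, hu, hSc⟩ := hS₁ u hu
          exact ⟨Q, S, Q₂, hQ, hS, hQ₂, by simp [hu], by omega⟩
        · exact ⟨Q, Q₁, Q₂, hQ, hQ₁, hQ₂, by simp, by omega⟩
        · obtain ⟨S, hS, hu, hSc⟩ := hS₂ u hu
          exact ⟨Q, Q₁, S, hQ, hQ₁, hS, by simp [hu], by omega⟩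
      obtain ⟨S, S₁, S₂, hS, hS₁, hS₂, hu, hSc⟩ := key
      have key : ∃ w ∈ ({r, r₁, r₂} : Finset V), u = w ∨ u ∈ S ∪ S₁ ∪ S₂ := by
        rcases hu with hu | rfl | rfl | rfl
        · exact ⟨r, by simp, .inr hu⟩
        all_goals exact ⟨u, by simp, .inl rfl⟩
      obtain ⟨w, hw, hu⟩ := key
      obtain ⟨S', hS', hwS, hsub, hSc'⟩ := hS.exists_insert w
      have := card_union_three_le S' S₁ S₂
      refine ⟨_, hS'.graft hS₁ hS₂ ⟨w, by simp [hwS], hw⟩, ?_, by omega⟩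
      rcases hu with rfl | hu
      · simp [hwS]
      · exact Finset.union_subset_union_left (Finset.union_subset_union_left hsub) hu
  · right
    have key : ∃ S S₁ S₂, Covers E S ∧ Covers E₁ S₁ ∧ Covers E₂ S₂ ∧
        ((∃ x ∈ S ∪ S₁ ∪ S₂, x ∈ ({r, r₁, r₂} : Finset V)) ∨
          u ∈ S ∧ u ∈ S₁ ∨ u ∈ S ∧ u ∈ S₂ ∨ u ∈ S₁ ∧ u ∈ S₂) ∧
        3 * (S.card + S₁.card + S₂.card) ≤ T.card + T₁.card + T₂.card := by
      simp only [Multiset.mem_cons] at hu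
      by_cases hur : u ∈ ({r, r₁, r₂} : Finset V)
      · have : u ∈ T ∨ u ∈ T₁ ∨ u ∈ T₂ := by
          by_contra! hcon
          simp only [hcon.1, hcon.2.1, hcon.2.2, or_false] at hu
          rcases hu with ⟨rfl, h⟩ | ⟨rfl, h⟩ | ⟨rfl, h⟩
          · exact hne.1 h
          · exact hne.2.1 h
          · exact hne.2.2 h
        rcases this with hu | hu | hu
        · obtain ⟨S, hS, hu, hSc⟩ := hS u hu
          exact ⟨S, Q₁, Q₂, hS, hQ₁, hQ₂, .inl ⟨u, by simp [hu], hur⟩, by omega⟩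
        · obtain ⟨S, hS, hu, hSc⟩ := hS₁ u hu
          exact ⟨Q, S, Q₂, hQ, hS, hQ₂, .inl ⟨u, by simp [hu], hur⟩, by omega⟩
        · obtain ⟨S, hS, hu, hSc⟩ := hS₂ u hu
          exact ⟨Q, Q₁, S, hQ, hQ₁, hS, .inl ⟨u, by simp [hu], hur⟩, by omega⟩
      · simp only [Finset.mem_insert, Finset.mem_singleton, not_or] at hur
        simp only [hur.1, hur.2.1, hur.2.2, false_or] at hu
        rcases hu with ⟨hu, hu'⟩ | ⟨hu, hu'⟩ | ⟨hu, hu'⟩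
        · obtain ⟨S, hS, hu, hSc⟩ := hS u hu
          obtain ⟨S', hS', hu', hSc'⟩ := hS₁ u hu'
          exact ⟨S, S', Q₂, hS, hS', hQ₂, by simp [*], by omega⟩
        · obtain ⟨S, hS, hu, hSc⟩ := hS u hu
          obtain ⟨S', hS', hu', hSc'⟩ := hS₂ u hu'
          exact ⟨S, Q₁, S', hS, hQ₁, hS', by simp [*], by omega⟩
        · obtain ⟨S, hS, hu, hSc⟩ := hS₁ u hu
          obtain ⟨S', hS', hu', hSc'⟩ := hS₂ u hu'
          exact ⟨Q, S, S', hQ, hS, hS', by simp [*], by omega⟩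
    obtain ⟨S, S₁, S₂, hS, hS₁, hS₂, hx | hu, hSc⟩ := key
    · have := card_union_three_le S S₁ S₂
      exact Loose.of_card_le (hS.graft hS₁ hS₂ hx) (by omega)
    · obtain ⟨S', hS', hr, hsub, hSc'⟩ := hS.exists_insert r
      have := card_union_three_lt (S := S') (S₁ := S₁) (S₂ := S₂) (u := u)
        (hu.imp (And.imp_left (hsub ·)) (Or.imp_left (And.imp_left (hsub ·))))
      exact Loose.of_card_le (hS'.graft hS₁ hS₂ ⟨r, by simp [hr], by simp⟩) (by omega)

theorem RTree.trichotomy {r : V} {T : Multiset V} {E : Multiset (Finset V)} (h : RTree r T E)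
    (h3 : ∀ e ∈ E, e.card = 3) : Tight r T E ∨ NearTight r T E ∨ Loose r T E := by
  induction h with
  | leaf r =>
    exact .inr (.inl ⟨by simp, ⟨∅, by simp, by simp, by simp⟩, ⟨∅, by simp [Covers], by simp⟩,
      by simp⟩)
  | graft h h₁ h₂ ih ih₁ ih₂ =>
    simp only [Multiset.mem_cons, Multiset.mem_add] at h3
    rcases loose_graft_or (ih fun e he => h3 e (.inr (.inl (.inl he))))
      (ih₁ fun e he => h3 e (.inr (.inl (.inr he))))
      (ih₂ fun e he => h3 e (.inr (.inr he))) with hL | ⟨a, b, c⟩ | ⟨a, b, c⟩ | ⟨a, b, c⟩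
    · exact .inr (.inr hL)
    · exact (graft_tight a b c).imp_right .inr
    · exact (graft_nearTight a b c (h3 _ (.inl rfl))).imp_right .inr
    · exact .inr (graft_nearTight_tight a b c)

/-- A path avoiding the edge `e` between two vertices of `e` closes up to a cycle. -/
theorem hasCycle_of_reachable {E F : Finset (Finset V)} (hFE : F ⊆ E) {e : Finset V}
    (heE : e ∈ E) (heF : e ∉ F) {p q : V} (hpq : p ≠ q) (hp : p ∈ e) (hq : q ∈ e)
    (h : Relation.ReflTransGen (Adj F) p q) : HasCycle E := by
  let G : SimpleGraph V :=
    { Adj a b := a ≠ b ∧ Adj F a b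
      symm := ⟨fun _ _ h => ⟨h.1.symm, h.2.symm⟩⟩
      loopless := ⟨fun _ h => h.1 rfl⟩ }
  have hreach : G.Reachable p q := by
    have key : ∀ z, Relation.ReflTransGen (Adj F) p z → G.Reachable p z := fun z hz => by
      induction hz with
      | refl => exact .refl _
      | @tail b c _ hbc ih =>
        by_cases hne : b = c
        · exact hne ▸ ih
        · exact ih.trans (SimpleGraph.Adj.reachable ⟨hne, hbc⟩)
    exact key q h
  obtain ⟨w, hw⟩ := hreach.exists_walk_length_eq_dist
  have hinj := (w.isPath_of_length_eq_dist hw).getVert_injOn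
  set n := w.length with hn
  have hn0 : 0 < n := by
    rcases Nat.eq_zero_or_pos n with h0 | h0
    · exact absurd (SimpleGraph.Walk.eq_of_length_eq_zero h0) hpq
    · exact h0
  have hadj : ∀ i, ∃ f, i < n → f ∈ F ∧ w.getVert i ∈ f ∧ w.getVert (i + 1) ∈ f := by
    intro i
    by_cases hi : i < n
    · obtain ⟨-, f, hf, h₁, h₂⟩ := w.adj_getVert_succ hi
      exact ⟨f, fun _ => ⟨hf, h₁, h₂⟩⟩
    · exact ⟨∅, fun h => absurd h hi⟩
  choose f hf using hadj
  have hfinj : ∀ i j, i < j → j < n → f i ≠ f j := by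
    intro i j hij hj heq
    have hne : w.getVert i ≠ w.getVert (j + 1) := fun h => by
      have := hinj (by simp; omega) (by simp; omega) h
      omega
    have ha : G.Adj (w.getVert i) (w.getVert (j + 1)) :=
      ⟨hne, f i, (hf i (by omega)).1, (hf i (by omega)).2.1, heq ▸ (hf j hj).2.2⟩
    have := SimpleGraph.dist_le ((w.take i).append (.cons ha (w.drop (j + 1))))
    simp only [SimpleGraph.Walk.length_append, SimpleGraph.Walk.length_cons,
      SimpleGraph.Walk.take_length, SimpleGraph.Walk.drop_length] at this
    omega
  refine ⟨{
    k := n + 1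
    two_le := by omega
    v := fun i => w.getVert i.val
    e := fun i => if i.val < n then f i.val else e
    v_inj := fun i j hij => ?_
    e_inj := fun i j hij => ?_
    e_mem := fun i => ?_
    mem_left := fun i => ?_
    mem_right := fun i => ?_ }⟩
  · have hi := ZMod.val_lt i
    have hj := ZMod.val_lt j
    exact ZMod.val_injective _ (hinj (by simp; omega) (by simp; omega) hij)
  · have hi := ZMod.val_lt i
    have hj := ZMod.val_lt j
    apply ZMod.val_injective
    dsimp only at hij
    split_ifs at hij with h₁ h₂ h₂
    · rcases lt_trichotomy i.val j.val with h | h | h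
      · exact absurd hij (hfinj _ _ h h₂)
      · exact h
      · exact absurd hij.symm (hfinj _ _ h h₁)
    · exact absurd (hij ▸ (hf _ h₁).1) heF
    · exact absurd (hij ▸ (hf _ h₂).1) heF
    · omega
  · split_ifs with h
    · exact hFE (hf _ h).1
    · exact heE
  · have hi := ZMod.val_lt i
    split_ifs with h
    · exact (hf _ h).2.1
    · rw [show i.val = n by omega, hn, w.getVert_length]
      exact hq
  · have hi := ZMod.val_lt i
    split_ifs with h
    · have hval : (i + 1).val = i.val + 1 := by
        rw [← ZMod.val_natCast_of_lt (show i.val + 1 < n + 1 by omega)]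
        push_cast
        rw [ZMod.natCast_zmod_val]
      rw [hval]
      exact (hf _ h).2.2
    · have : i + 1 = 0 := by
        rw [← ZMod.natCast_zmod_val i, show i.val = n by omega]
        exact_mod_cast ZMod.natCast_self (n + 1)
      rw [this, ZMod.val_zero, w.getVert_zero]
      exact hp

theorem exists_edge_meeting {E F : Finset (Finset V)} (h3 : Uniform3 E) (hconn : HConnected E)
    {U : Finset V} (hF : ∀ e ∈ F, e ⊆ U) (hU : U.Nonempty) (hFE : F ⊆ E) (hne : F ≠ E) :
    ∃ e ∈ E, e ∉ F ∧ ∃ p ∈ U, p ∈ e := by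
  by_contra! hcon
  obtain ⟨a, ha⟩ := hU
  have huniv : ∀ x, x ∈ U := fun x => by
    induction hconn a x with
    | refl => exact ha
    | tail _ h ih =>
      obtain ⟨e, he, hb, hc⟩ := h
      by_cases heF : e ∈ F
      · exact hF e heF hc
      · exact absurd hb (hcon e he heF _ ih)
  obtain ⟨e, he, heF⟩ := Finset.exists_of_ssubset (hFE.ssubset_of_ne hne)
  obtain ⟨x, hx⟩ := Finset.card_pos.1 (by rw [h3 e he]; norm_num : 0 < e.card)
  exact hcon e he heF x (huniv x) hx

theorem card_le_add_two_mul {E : Finset (Finset V)} (h3 : Uniform3 E) (hconn : HConnected E)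
    {F : Finset (Finset V)} {U : Finset V} (hF : ∀ e ∈ F, e ⊆ U) (hU : U.Nonempty)
    (hFE : F ⊆ E) : Fintype.card V + 2 * F.card ≤ U.card + 2 * E.card := by
  induction hn : E.card - F.card generalizing F U with
  | zero =>
    have hEF : F = E := Finset.eq_of_subset_of_card_le hFE (by omega)
    subst hEF
    obtain ⟨a, ha⟩ := hU
    have huniv : U = Finset.univ := Finset.eq_univ_iff_forall.2 fun x => by
      induction hconn a x with
      | refl => exact ha
      | tail _ h ih =>
        obtain ⟨e, he, hb, hc⟩ := h
        exact hF e he hc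
    rw [huniv, Finset.card_univ]
  | succ n ih =>
    obtain ⟨e, he, heF, p, hp, hpe⟩ := exists_edge_meeting h3 hconn hF hU hFE
      (by rintro rfl; omega)
    have hcF : (insert e F).card = F.card + 1 := Finset.card_insert_of_notMem heF
    have := ih (F := insert e F) (U := U ∪ e)
      (fun f hf => by
        rcases Finset.mem_insert.1 hf with rfl | hf
        · exact Finset.subset_union_right
        · exact (hF f hf).trans Finset.subset_union_left)
      (hU.mono Finset.subset_union_left)
      (Finset.insert_subset he hFE) (by omega)
    have h₁ := Finset.card_union_add_card_inter U e
    have h₂ : 0 < (U ∩ e).card := Finset.card_pos.2 ⟨p, by simp [hp, hpe]⟩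
    have := h3 e he
    omega

theorem card_le_of_hasCycle {E : Finset (Finset V)} (h3 : Uniform3 E) (hconn : HConnected E)
    (h : HasCycle E) : Fintype.card V ≤ 2 * E.card := by
  obtain ⟨C⟩ := h
  have h2 := C.two_le
  have : NeZero C.k := ⟨by omega⟩
  have : Fact (1 < C.k) := ⟨by omega⟩
  have hF : (Finset.univ.image C.e).card = C.k := by
    rw [Finset.card_image_of_injective _ C.e_inj, Finset.card_univ, ZMod.card]
  have hU : (Finset.univ.biUnion fun i => (C.e i).erase (C.v (i + 1))).card ≤ C.k * 2 := by
    refine (Finset.card_biUnion_le_card_mul _ _ 2 fun i _ => ?_).trans_eq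
      (by rw [Finset.card_univ, ZMod.card])
    rw [Finset.card_erase_of_mem (C.mem_right i), h3 _ (C.e_mem i)]
  have := card_le_add_two_mul h3 hconn (F := Finset.univ.image C.e)
    (U := Finset.univ.biUnion fun i => (C.e i).erase (C.v (i + 1))) ?_ ?_ ?_
  · omega
  · intro e he x hx
    obtain ⟨i, -, rfl⟩ := Finset.mem_image.1 he
    by_cases hxi : x = C.v (i + 1)
    · refine Finset.mem_biUnion.2 ⟨i + 1, Finset.mem_univ _, Finset.mem_erase.2 ⟨?_, ?_⟩⟩
      · rw [hxi]
        exact fun h => by simpa using C.v_inj h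
      · rw [hxi]
        exact C.mem_left _
    · exact Finset.mem_biUnion.2 ⟨i, Finset.mem_univ _, Finset.mem_erase.2 ⟨hxi, hx⟩⟩
  · refine ⟨C.v 0, Finset.mem_biUnion.2 ⟨0, Finset.mem_univ _,
      Finset.mem_erase.2 ⟨fun h => by simpa using C.v_inj h, C.mem_left 0⟩⟩⟩
  · intro e he
    obtain ⟨i, -, rfl⟩ := Finset.mem_image.1 he
    exact C.e_mem i

/-- A connected 3-uniform hypergraph is obtained from a hypertree with the same edges by
identifying vertices, and no identification is needed in the acyclic case. -/
theorem exists_rtree {E : Finset (Finset V)} (h3 : Uniform3 E) (hconn : HConnected E) :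
    ∃ r T, RTree r T E.val ∧ (∀ x, x ∈ r ::ₘ T) ∧ (¬ HasCycle E → (r ::ₘ T).Nodup) := by
  obtain ⟨r⟩ := ‹Nonempty V›
  have grow : ∀ k ≤ E.card, ∃ F ⊆ E, F.card = k ∧ ∃ T, RTree r T F.val ∧
      (¬ HasCycle E → (r ::ₘ T).Nodup) := by
    intro k
    induction k with
    | zero => exact fun _ => ⟨∅, by simp, rfl, 0, .leaf r, by simp⟩
    | succ k ih =>
      intro hk
      obtain ⟨F, hFE, hFk, T, hT, hnd⟩ := ih (by omega)
      obtain ⟨e, he, heF, p, hp, hpe⟩ := exists_edge_meeting h3 hconn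
        (U := (r ::ₘ T).toFinset)
        (fun e he x hx => Multiset.mem_toFinset.2 (hT.mem_of_mem_edge he hx))
        ⟨r, by simp⟩ hFE (by rintro rfl; omega)
      rw [Multiset.mem_toFinset] at hp
      obtain ⟨x, y, hxy, hxye⟩ := Finset.card_eq_two.1
        (by rw [Finset.card_erase_of_mem hpe, h3 e he] : (e.erase p).card = 2)
      have hee : e = {p, x, y} := by rw [← Finset.insert_erase hpe, hxye]
      have hcyc : ∀ z ∈ e.erase p, ¬ HasCycle E → z ∉ r ::ₘ T := fun z hz hac hzT =>
        hac (hasCycle_of_reachable hFE he heF (Finset.ne_of_mem_erase hz).symm hpe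
          (Finset.mem_of_mem_erase hz)
          ((reflTransGen_adj_symm (hT.reachable (fun _ h => h) hp)).trans
            (hT.reachable (fun _ h => h) hzT)))
      refine ⟨insert e F, Finset.insert_subset he hFE,
        by rw [Finset.card_insert_of_notMem heF, hFk], x ::ₘ y ::ₘ T, ?_, fun hac => ?_⟩
      · rw [Finset.insert_val_of_notMem heF, hee]
        exact hT.attach hp x y
      · have hx := hcyc x (by simp [hxye]) hac
        have hy := hcyc y (by simp [hxye]) hac
        have := hnd hac
        simp only [Multiset.nodup_cons, Multiset.mem_cons, not_or] at hx hy this ⊢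
        exact ⟨⟨Ne.symm hx.1, Ne.symm hy.1, this.1⟩, ⟨hxy, hx.2⟩, hy.2, this.2⟩
  obtain ⟨F, hFE, hF, T, hT, hnd⟩ := grow _ le_rfl
  obtain rfl := Finset.eq_of_subset_of_card_le hFE hF.ge
  refine ⟨r, T, hT, fun x => ?_, hnd⟩
  induction hconn r x with
  | refl => simp
  | tail _ h ih =>
    obtain ⟨e, he, hb, hc⟩ := h
    exact hT.mem_of_mem_edge he hc

theorem coverNum_le {E : Finset (Finset V)} {S : Finset V} (h : IsVertexCover E S) :
    coverNum E ≤ S.card :=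
  Nat.sInf_le ⟨S, h, rfl⟩

theorem exists_card_eq_coverNum {E : Finset (Finset V)} (h3 : Uniform3 E) :
    ∃ S, IsVertexCover E S ∧ S.card = coverNum E := by
  refine Nat.sInf_mem (s := {n | ∃ S : Finset V, IsVertexCover E S ∧ S.card = n})
    ⟨_, Finset.univ, fun e he => ?_, rfl⟩
  obtain ⟨x, hx⟩ := Finset.card_pos.1 (by rw [h3 e he]; norm_num : 0 < e.card)
  exact ⟨x, Finset.mem_univ _, hx⟩

theorem IsMatching.card_le {E M : Finset (Finset V)} (hM : IsMatching E M) {S : Finset V}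
    (hS : IsVertexCover E S) : M.card ≤ S.card := by
  choose! f hfS hfe using hS
  refine Finset.card_le_card_of_injOn f (fun e he => hfS e (hM.1 he)) fun e he e' he' h => ?_
  by_contra hne
  exact Finset.disjoint_left.1 (hM.2 e he e' he' hne) (hfe e (hM.1 he))
    (h ▸ hfe e' (hM.1 he'))

theorem card_le_of_covering {M : Finset (Finset V)} {U : Finset V} (h3 : Uniform3 M)
    (hU : ∀ x ∈ U, ∃ e ∈ M, x ∈ e) : U.card ≤ M.card * 3 :=
  (Finset.card_le_card fun x hx => by simpa using hU x hx).trans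
    (Finset.card_biUnion_le_card_mul M id 3 fun e he => (h3 e he).le)

theorem isMatching_of_covering {E M : Finset (Finset V)} (h3 : Uniform3 E) (hM : M ⊆ E)
    (hcov : ∀ x, ∃ e ∈ M, x ∈ e) (hc : 3 * M.card ≤ Fintype.card V) : IsMatching E M := by
  refine ⟨hM, fun e he f hf hne => Finset.disjoint_left.2 fun x hxe hxf => ?_⟩
  have h₁ := card_le_of_covering (M := M.erase e) (U := Finset.univ \ e.erase x)
    (fun g hg => h3 g (hM (Finset.mem_of_mem_erase hg))) fun y hy => by
      by_cases hyx : y = x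
      · exact ⟨f, by simp [hf, hne.symm], hyx ▸ hxf⟩
      · obtain ⟨g, hg, hyg⟩ := hcov y
        refine ⟨g, Finset.mem_erase.2 ⟨?_, hg⟩, hyg⟩
        rintro rfl
        simp [hyx, hyg] at hy
  rw [Finset.card_sdiff_of_subset (Finset.subset_univ _), Finset.card_univ,
    Finset.card_erase_of_mem hxe, Finset.card_erase_of_mem he, h3 e (hM he)] at h₁
  have := Finset.card_pos.2 ⟨e, he⟩
  omega

/-- For a connected 3-uniform hypergraph with m edges,
τ(H) = (2m+1)/3 iff H is a hypertree admitting a perfect matching. -/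
theorem stmt1 (E : Finset (Finset V)) (h3 : Uniform3 E) (hconn : HConnected E) :
    3 * coverNum E = 2 * E.card + 1 ↔ IsHypertree E ∧ HasPerfectMatching E := by
  obtain ⟨r, T, hT, hspan, hnd⟩ := exists_rtree h3 hconn
  have hcT : T.card = 2 * E.card := hT.card_eq
  have hcV : (r ::ₘ T).Nodup → Fintype.card V = 2 * E.card + 1 := fun h => by
    rw [← hcT, ← Multiset.card_cons r T, ← Multiset.toFinset_card_of_nodup h,
      ← Finset.card_univ]
    congr 1
    ext x
    simpa using hspan x
  have htri := hT.trichotomy h3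
  constructor
  · intro heq
    rcases htri with h | h | h
    · obtain ⟨hn, ⟨M, hM, hMc, hMv⟩, -⟩ := h
      have := hcV hn
      refine ⟨⟨hconn, fun hC => ?_⟩, M,
        isMatching_of_covering h3 hM (fun x => hMv x (hspan x)) (by omega),
        fun x => hMv x (hspan x)⟩
      have := card_le_of_hasCycle h3 hconn hC
      omega
    · obtain ⟨S, S', hS, -, -, hc, -⟩ := h.exists_covers
      have := coverNum_le hS
      omega
    · obtain ⟨S, S', hS, -, -, hc⟩ := h.exists_covers
      have := coverNum_le hS
      omega
  · rintro ⟨⟨-, hac⟩, M, hM, hMv⟩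
    have hV := hcV (hnd hac)
    have hcov := card_le_of_covering (U := Finset.univ) (fun e he => h3 e (hM.1 he))
      fun x _ => hMv x
    rw [Finset.card_univ] at hcov
    obtain ⟨S, hS, hSc⟩ := exists_card_eq_coverNum h3
    have hMS := hM.card_le hS
    have hle : 3 * coverNum E ≤ 2 * E.card + 1 := by
      rcases htri with h | h | h
      · obtain ⟨S, S', hS, -, -, hc, -⟩ := h.exists_covers
        have := coverNum_le hS
        omega
      · obtain ⟨S, S', hS, -, -, hc, -⟩ := h.exists_covers
        have := coverNum_le hS
        omega
      · obtain ⟨S, S', hS, -, -, hc⟩ := h.exists_covers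
        have := coverNum_le hS
        omega
    omega
end

section
/- Let H = (V, E) be a connected 3-uniform hypergraph with m edges satisfying τ(H) = (2m + 1)/3. Then H is a hypertree and H admits a perfect matching. -/
variable {V : Type*} [Fintype V] [DecidableEq V] [Nonempty V]

/-- A family of 3-sets built one edge at a time, each new edge meeting the union of the
previous ones in at most one vertex. -/
inductive IsForest {α : Type*} [DecidableEq α] : Finset (Finset α) → Prop
  | empty : IsForest ∅
  | cons (F : Finset (Finset α)) (e : Finset α) : IsForest F → e ∉ F → e.card = 3 →
      (∀ a ∈ e, ∀ b ∈ e, a ∈ F.sup id → b ∈ F.sup id → a = b) → IsForest (insert e F)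

/-- The three sets `S 0`, `S 1`, `S 2` contain a system of representatives exhausting every edge
of `F`. -/
def IsRainbow {α : Type*} [DecidableEq α] (F : Finset (Finset α)) (S : Fin 3 → Finset α) : Prop :=
  ∀ e ∈ F, ∃ r : Fin 3 → α, (∀ i, r i ∈ S i) ∧ e = Finset.univ.image r

section

variable {α : Type*} [DecidableEq α]

theorem mem_sup_id_iff {F : Finset (Finset α)} {x : α} : x ∈ F.sup id ↔ ∃ e ∈ F, x ∈ e := by
  simp [Finset.mem_sup]

theorem IsForest.filter {F : Finset (Finset α)} (hF : IsForest F) (p : Finset α → Prop)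
    [DecidablePred p] : IsForest (F.filter p) := by
  induction hF with
  | empty => simpa using IsForest.empty
  | cons F e _ he hc h ih =>
    rw [Finset.filter_insert]
    split_ifs with hp
    · refine IsForest.cons _ e ih (by simp [he]) hc fun a ha b hb hA hB => h a ha b hb ?_ ?_
      · exact Finset.sup_mono (f := id) (Finset.filter_subset p F) hA
      · exact Finset.sup_mono (f := id) (Finset.filter_subset p F) hB
    · exact ih

/-- The König property of forests: some matching is as large as some vertex cover. -/
theorem IsForest.exists_matching_cover {F : Finset (Finset α)} (hF : IsForest F) :
    ∃ (M : Finset (Finset α)) (S : Finset α), M ⊆ F ∧ (M : Set (Finset α)).PairwiseDisjoint id ∧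
      (∀ e ∈ F, ∃ x ∈ S, x ∈ e) ∧ S.card ≤ M.card := by
  induction hn : F.card using Nat.strong_induction_on generalizing F with
  | _ n ih =>
    cases hF with
    | empty => exact ⟨∅, ∅, by simp⟩
    | cons F e hF he hc h =>
      obtain ⟨a, ha, hauniq⟩ : ∃ a ∈ e, ∀ b ∈ e, b ∈ F.sup id → b = a := by
        by_cases hex : ∃ a ∈ e, a ∈ F.sup id
        · obtain ⟨a, ha, haF⟩ := hex
          exact ⟨a, ha, fun b hb hbF => h b hb a ha hbF haF⟩
        · obtain ⟨a, ha⟩ : e.Nonempty := Finset.card_pos.1 (by omega)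
          exact ⟨a, ha, fun b hb hbF => (hex ⟨b, hb, hbF⟩).elim⟩
      have hlt : (F.filter (a ∉ ·)).card < n := by
        have := Finset.card_filter_le F (a ∉ ·)
        rw [Finset.card_insert_of_notMem he] at hn
        omega
      obtain ⟨M, S, hMF, hM, hS, hcard⟩ := ih _ hlt (hF.filter (a ∉ ·)) rfl
      have hdisj : ∀ f ∈ M, Disjoint e f := by
        intro f hf
        have hf' := Finset.mem_filter.1 (hMF hf)
        rw [Finset.disjoint_left]
        intro x hxe hxf
        exact hf'.2 (hauniq x hxe (mem_sup_id_iff.2 ⟨f, hf'.1, hxf⟩) ▸ hxf)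
      have heM : e ∉ M := fun h' => he (Finset.mem_filter.1 (hMF h')).1
      refine ⟨insert e M, insert a S, ?_, ?_, ?_, ?_⟩
      · exact Finset.insert_subset_insert e (hMF.trans (Finset.filter_subset _ _))
      · rw [Finset.coe_insert]
        exact hM.insert fun f hf _ => hdisj f hf
      · intro f hf
        by_cases haf : a ∈ f
        · exact ⟨a, Finset.mem_insert_self a S, haf⟩
        · obtain rfl | hf := Finset.mem_insert.1 hf
          · exact (haf ha).elim
          · obtain ⟨x, hx, hxf⟩ := hS f (Finset.mem_filter.2 ⟨hf, haf⟩)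
            exact ⟨x, Finset.mem_insert_of_mem hx, hxf⟩
      · rw [Finset.card_insert_of_notMem heM]
        exact (Finset.card_insert_le a S).trans (by omega)

theorem exists_enum_of_card_eq_three {e : Finset α} (he : e.card = 3) {a x : α} (ha : a ∈ e)
    (hx : x ∈ e) (hax : a ≠ x) {i j : Fin 3} (hij : i ≠ j) :
    ∃ r : Fin 3 → α, r i = a ∧ r j = x ∧ e = Finset.univ.image r := by
  obtain ⟨y, hy⟩ : ∃ y, (e.erase a).erase x = {y} := by
    rw [← Finset.card_eq_one, Finset.card_erase_of_mem (by simp [hx, hax.symm]),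
      Finset.card_erase_of_mem ha, he]
  have hye : e = {a, x, y} := by
    rw [← Finset.insert_erase ha, ← Finset.insert_erase (a := x) (s := e.erase a)
      (by simp [hx, hax.symm]), hy]
  refine ⟨fun t => if t = i then a else if t = j then x else y, by simp, by simp [hij.symm], ?_⟩
  rw [hye]
  ext z
  fin_cases i <;> fin_cases j <;> simp [Fin.exists_fin_succ, eq_comm] at hij ⊢ <;> tauto

theorem IsRainbow.exists_mem {F : Finset (Finset α)} {S : Fin 3 → Finset α} (hS : IsRainbow F S)
    {x : α} (hx : x ∈ F.sup id) : ∃ i, x ∈ S i := by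
  obtain ⟨e, he, hxe⟩ := mem_sup_id_iff.1 hx
  obtain ⟨r, hr, rfl⟩ := hS e he
  obtain ⟨i, -, rfl⟩ := Finset.mem_image.1 hxe
  exact ⟨i, hr i⟩

theorem IsRainbow.exists_insert {F : Finset (Finset α)} {S : Fin 3 → Finset α}
    (hS : IsRainbow F S) {e : Finset α} (he : e.card = 3) {a x : α} (ha : a ∈ e) (hx : x ∈ e)
    (hax : a ≠ x) {i j : Fin 3} (hij : i ≠ j) (hai : a ∈ S i) :
    ∃ S' : Fin 3 → Finset α, IsRainbow (insert e F) S' ∧ (∀ t, S t ⊆ S' t) ∧ x ∈ S' j ∧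
      ∑ t, (S' t).card ≤ ∑ t, (S t).card + 2 ∧
      (x ∈ S j → ∑ t, (S' t).card ≤ ∑ t, (S t).card + 1) := by
  obtain ⟨r, rfl, rfl, hr⟩ := exists_enum_of_card_eq_three he ha hx hax hij
  have hle : ∀ t, (insert (r t) (S t)).card ≤ (S t).card + 1 := fun t => Finset.card_insert_le _ _
  have hi : (insert (r i) (S i)).card = (S i).card := by rw [Finset.insert_eq_of_mem hai]
  have h0 := hle 0
  have h1 := hle 1
  have h2 := hle 2
  have hi_cases : i = 0 ∨ i = 1 ∨ i = 2 := by omega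
  have hj_cases : j = 0 ∨ j = 1 ∨ j = 2 := by omega
  refine ⟨fun t => insert (r t) (S t), ?_, fun t => Finset.subset_insert _ _,
    Finset.mem_insert_self _ _, ?_, fun hj => ?_⟩
  · intro f hf
    obtain rfl | hf := Finset.mem_insert.1 hf
    · exact ⟨r, fun t => Finset.mem_insert_self _ _, hr⟩
    · obtain ⟨q, hq, hfq⟩ := hS f hf
      exact ⟨q, fun t => Finset.mem_insert_of_mem (hq t), hfq⟩
  · simp only [Fin.sum_univ_three]
    obtain rfl | rfl | rfl := hi_cases <;> omega
  · have hj' : (insert (r j) (S j)).card = (S j).card := by rw [Finset.insert_eq_of_mem hj]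
    simp only [Fin.sum_univ_three]
    obtain rfl | rfl | rfl := hi_cases <;> obtain rfl | rfl | rfl := hj_cases <;>
      first | exact absurd rfl hij | omega

/-- A hypertree with `n` edges on at most `2 * n + 1` vertices, any two of whose vertices are
separated by a rainbow colouring of total weight at most `2 * n + 1`. -/
structure IsSeparatedTree (F : Finset (Finset α)) : Prop where
  forest : IsForest F
  card_le : (F.sup id).card ≤ 2 * F.card + 1
  exists_rainbow : ∃ S, IsRainbow F S ∧ ∑ t, (S t).card ≤ 2 * F.card + 1
  separated : ∀ a ∈ F.sup id, ∀ x ∈ F.sup id, a ≠ x → ∃ S, IsRainbow F S ∧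
    ∑ t, (S t).card ≤ 2 * F.card + 1 ∧ ∃ i j, i ≠ j ∧ a ∈ S i ∧ x ∈ S j

theorem IsSeparatedTree.singleton {e : Finset α} (he : e.card = 3) : IsSeparatedTree {e} := by
  have hrain : ∃ S, IsRainbow {e} S ∧ ∑ t, (S t).card ≤ 2 * ({e} : Finset (Finset α)).card + 1 := by
    obtain ⟨a, x, _, hax, -, -, h⟩ := Finset.card_eq_three.1 he
    obtain ⟨r, -, -, hr⟩ := exists_enum_of_card_eq_three he (a := a) (x := x) (by simp [h])
      (by simp [h]) hax (i := 0) (j := 1) (by decide)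
    refine ⟨fun t => {r t}, ?_, by simp⟩
    intro f hf
    rw [Finset.mem_singleton] at hf
    exact ⟨r, by simp, hf ▸ hr⟩
  refine ⟨?_, by simp [he], hrain, ?_⟩
  · exact IsForest.cons ∅ e IsForest.empty (by simp) he (by simp)
  · intro a ha x hx hax
    obtain ⟨S, hS, hcard⟩ := hrain
    refine ⟨S, hS, hcard, ?_⟩
    obtain ⟨r, hr, rfl⟩ := hS e (by simp)
    simp only [Finset.sup_singleton, id, Finset.mem_image, Finset.mem_univ, true_and] at ha hx
    obtain ⟨i, rfl⟩ := ha
    obtain ⟨j, rfl⟩ := hx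
    exact ⟨i, j, fun h => hax (h ▸ rfl), hr i, hr j⟩

theorem IsSeparatedTree.insert_edge {F : Finset (Finset α)} (hF : IsSeparatedTree F) {e : Finset α}
    (heF : e ∉ F) (he : e.card = 3) {b : α} (hb : b ∈ e) (hbF : b ∈ F.sup id)
    (h : ∀ x ∈ e, x ∈ F.sup id → x = b) : IsSeparatedTree (insert e F) := by
  have hcard : (insert e F).card = F.card + 1 := Finset.card_insert_of_notMem heF
  obtain ⟨y, hy, hyb⟩ : ∃ y ∈ e, y ≠ b := Finset.exists_mem_ne (by omega) b
  have hext : ∀ S : Fin 3 → Finset α, IsRainbow F S → ∑ t, (S t).card ≤ 2 * F.card + 1 →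
      ∃ S' : Fin 3 → Finset α, IsRainbow (insert e F) S' ∧
        ∑ t, (S' t).card ≤ 2 * (insert e F).card + 1 ∧ ∀ t, S t ⊆ S' t := by
    intro S hS hw
    obtain ⟨i, hi⟩ := hS.exists_mem hbF
    obtain ⟨j, hj⟩ := exists_ne i
    obtain ⟨S', hS', hsub, -, hw', -⟩ := hS.exists_insert he hb hy hyb.symm hj.symm hi
    exact ⟨S', hS', by omega, hsub⟩
  have hmixed : ∀ a ∈ F.sup id, ∀ x ∈ e, x ≠ b → ∃ S, IsRainbow (insert e F) S ∧
      ∑ t, (S t).card ≤ 2 * (insert e F).card + 1 ∧ ∃ i j, i ≠ j ∧ a ∈ S i ∧ x ∈ S j := by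
    intro a ha x hx hxb
    obtain ⟨S, hS, hw⟩ := hF.exists_rainbow
    obtain ⟨i, hi⟩ := hS.exists_mem hbF
    obtain ⟨l, hl⟩ := hS.exists_mem ha
    obtain ⟨j, hji, hjl⟩ : ∃ j : Fin 3, i ≠ j ∧ l ≠ j :=
      (by decide : ∀ i l : Fin 3, ∃ j, i ≠ j ∧ l ≠ j) i l
    obtain ⟨S', hS', hsub, hxj, hw', -⟩ := hS.exists_insert he hb hx hxb.symm hji hi
    exact ⟨S', hS', by omega, l, j, hjl, hsub l hl, hxj⟩
  have hsup : (insert e F).sup id = e ∪ F.sup id := by simp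
  refine ⟨?_, ?_, ?_, ?_⟩
  · exact IsForest.cons F e hF.forest heF he fun p hp q hq hpF hqF =>
      (h p hp hpF).trans (h q hq hqF).symm
  · have hinter : 0 < (e ∩ F.sup id).card :=
      Finset.card_pos.2 ⟨b, Finset.mem_inter.2 ⟨hb, hbF⟩⟩
    have := Finset.card_union_add_card_inter e (F.sup id)
    have := hF.card_le
    rw [hsup]
    omega
  · obtain ⟨S, hS, hw⟩ := hF.exists_rainbow
    obtain ⟨S', hS', hw', -⟩ := hext S hS hw
    exact ⟨S', hS', hw'⟩
  · intro a ha x hx hax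
    rw [hsup, Finset.mem_union] at ha hx
    by_cases haF : a ∈ F.sup id
    · by_cases hxF : x ∈ F.sup id
      · obtain ⟨S, hS, hw, i, j, hij, hai, hxj⟩ := hF.separated a haF x hxF hax
        obtain ⟨S', hS', hw', hsub⟩ := hext S hS hw
        exact ⟨S', hS', hw', i, j, hij, hsub i hai, hsub j hxj⟩
      · exact hmixed a haF x (hx.resolve_right hxF) fun hxb => hxF (hxb ▸ hbF)
    · have hae := ha.resolve_right haF
      by_cases hxF : x ∈ F.sup id
      · obtain ⟨S, hS, hw, i, j, hij, hxi, haj⟩ :=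
          hmixed x hxF a hae fun hab => haF (hab ▸ hbF)
        exact ⟨S, hS, hw, j, i, hij.symm, haj, hxi⟩
      · have hxe := hx.resolve_right hxF
        obtain ⟨S, hS, hw⟩ := hF.exists_rainbow
        obtain ⟨S', hS', hw', -⟩ := hext S hS hw
        refine ⟨S', hS', hw', ?_⟩
        obtain ⟨r, hr, hre⟩ := hS' e (Finset.mem_insert_self e F)
        rw [hre] at hae hxe
        obtain ⟨i, -, rfl⟩ := Finset.mem_image.1 hae
        obtain ⟨j, -, rfl⟩ := Finset.mem_image.1 hxe
        exact ⟨i, j, fun hij => hax (hij ▸ rfl), hr i, hr j⟩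

/-- Adding an edge meeting the previous ones preserves the alternative between being a separated
tree and having a rainbow colouring of weight at most twice the number of edges. -/
theorem isSeparatedTree_or_light_insert {F : Finset (Finset α)}
    (hF : IsSeparatedTree F ∨ ∃ S, IsRainbow F S ∧ ∑ t, (S t).card ≤ 2 * F.card)
    {e : Finset α} (heF : e ∉ F) (he : e.card = 3) {b : α} (hb : b ∈ e) (hbF : b ∈ F.sup id) :
    IsSeparatedTree (insert e F) ∨
      ∃ S, IsRainbow (insert e F) S ∧ ∑ t, (S t).card ≤ 2 * (insert e F).card := by
  have hcard : (insert e F).card = F.card + 1 := Finset.card_insert_of_notMem heF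
  obtain hF | ⟨S, hS, hw⟩ := hF
  · by_cases h : ∀ x ∈ e, x ∈ F.sup id → x = b
    · exact Or.inl (hF.insert_edge heF he hb hbF h)
    · push Not at h
      obtain ⟨x, hx, hxF, hxb⟩ := h
      obtain ⟨S, hS, hw, i, j, hij, hi, hj⟩ := hF.separated b hbF x hxF hxb.symm
      obtain ⟨S', hS', -, -, -, hw'⟩ := hS.exists_insert he hb hx hxb.symm hij hi
      have := hw' hj
      exact Or.inr ⟨S', hS', by omega⟩
  · obtain ⟨y, hy, hyb⟩ : ∃ y ∈ e, y ≠ b := Finset.exists_mem_ne (by omega) b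
    obtain ⟨i, hi⟩ := hS.exists_mem hbF
    obtain ⟨j, hj⟩ := exists_ne i
    obtain ⟨S', hS', -, -, hw', -⟩ := hS.exists_insert he hb hy hyb.symm hj.symm hi
    exact Or.inr ⟨S', hS', by omega⟩

theorem IsForest.not_hasCycle {F : Finset (Finset α)} (hF : IsForest F) : ¬ HasCycle F := by
  induction hF with
  | empty => exact fun ⟨C⟩ => by simpa using C.e_mem 0
  | cons F e _ he hc h ih =>
    rintro ⟨C⟩
    have : Fact (1 < C.k) := ⟨C.two_le⟩
    have hmem : ∀ i, C.e i ≠ e → C.e i ∈ F := fun i hi =>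
      (Finset.mem_insert.1 (C.e_mem i)).resolve_left hi
    by_cases hex : ∃ i, C.e i = e
    · obtain ⟨i, hi⟩ := hex
      have hprev : C.e (i - 1) ∈ F := hmem _ fun h' => by simpa using C.e_inj (h'.trans hi.symm)
      have hnext : C.e (i + 1) ∈ F := hmem _ fun h' => by simpa using C.e_inj (h'.trans hi.symm)
      have hv := h (C.v i) (hi.subset (C.mem_left i)) (C.v (i + 1)) (hi.subset (C.mem_right i))
        (mem_sup_id_iff.2 ⟨_, hprev, by simpa using C.mem_right (i - 1)⟩)
        (mem_sup_id_iff.2 ⟨_, hnext, C.mem_left (i + 1)⟩)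
      simpa using C.v_inj hv
    · push Not at hex
      exact ih ⟨{ C with e_mem := fun i => hmem i (hex i) }⟩

theorem HConnected.mem_sup {E : Finset (Finset α)} (hconn : HConnected E) {w : α}
    (hw : w ∈ E.sup id) (u : α) : u ∈ E.sup id := by
  obtain rfl | ⟨_, ⟨e, he, hue, -⟩, -⟩ := (hconn u w).cases_head
  · exact hw
  · exact mem_sup_id_iff.2 ⟨e, he, hue⟩

theorem HConnected.exists_edge_meeting {E F : Finset (Finset α)} (hconn : HConnected E)
    (hne : ∀ e ∈ E, e.Nonempty) (hF : F ⊂ E) (hF0 : (F.sup id).Nonempty) :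
    ∃ e ∈ E, e ∉ F ∧ ∃ b ∈ e, b ∈ F.sup id := by
  obtain ⟨f, hfE, hfF⟩ := Finset.exists_of_ssubset hF
  obtain ⟨w, hw⟩ := hne f hfE
  obtain ⟨u, hu⟩ := hF0
  by_contra! hcon
  have hreach : ∀ z, Relation.ReflTransGen (Adj E) u z → z ∈ F.sup id := by
    intro z hz
    induction hz with
    | refl => exact hu
    | tail _ hstep ih =>
      obtain ⟨e, he, hx, hy⟩ := hstep
      by_cases heF : e ∈ F
      · exact mem_sup_id_iff.2 ⟨e, heF, hy⟩
      · exact (hcon e he heF _ hx ih).elim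
  exact hcon f hfE hfF w hw (hreach w (hconn u w))

theorem HConnected.isSeparatedTree_or_light {E : Finset (Finset α)} (h3 : Uniform3 E)
    (hconn : HConnected E) (hE : E.Nonempty) :
    IsSeparatedTree E ∨ ∃ S, IsRainbow E S ∧ ∑ t, (S t).card ≤ 2 * E.card := by
  have hne : ∀ e ∈ E, e.Nonempty := fun e he => Finset.card_pos.1 (by rw [h3 e he]; omega)
  have key : ∀ n, n + 1 ≤ E.card → ∃ F ⊆ E, F.card = n + 1 ∧
      (IsSeparatedTree F ∨ ∃ S, IsRainbow F S ∧ ∑ t, (S t).card ≤ 2 * F.card) := by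
    intro n
    induction n with
    | zero =>
      intro _
      obtain ⟨e, he⟩ := hE
      exact ⟨{e}, by simpa using he, by simp, Or.inl (.singleton (h3 e he))⟩
    | succ n ih =>
      intro hn
      obtain ⟨F, hFE, hFc, hF⟩ := ih (by omega)
      have hss : F ⊂ E := hFE.ssubset_of_ne fun h => by rw [h] at hFc; omega
      obtain ⟨f, hf⟩ : F.Nonempty := Finset.card_pos.1 (by omega)
      obtain ⟨z, hz⟩ := hne f (hFE hf)
      obtain ⟨e, he, heF, b, hb, hbF⟩ :=
        hconn.exists_edge_meeting hne hss ⟨z, mem_sup_id_iff.2 ⟨f, hf, hz⟩⟩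
      exact ⟨insert e F, Finset.insert_subset he hFE,
        by rw [Finset.card_insert_of_notMem heF, hFc],
        isSeparatedTree_or_light_insert hF heF (h3 e he) hb hbF⟩
  have hpos := Finset.card_pos.2 hE
  obtain ⟨F, hFE, hFc, hF⟩ := key (E.card - 1) (by omega)
  obtain rfl := Finset.eq_of_subset_of_card_le hFE (by omega)
  exact hF

theorem coverNum_le_card {β : Type*} {E : Finset (Finset β)} {S : Finset β}
    (hS : IsVertexCover E S) :
    coverNum E ≤ S.card :=
  Nat.sInf_le ⟨S, hS, rfl⟩

theorem IsRainbow.isVertexCover {E : Finset (Finset α)} {S : Fin 3 → Finset α}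
    (hS : IsRainbow E S) (t : Fin 3) : IsVertexCover E (S t) := by
  intro e he
  obtain ⟨r, hr, rfl⟩ := hS e he
  exact ⟨r t, hr t, Finset.mem_image_of_mem r (Finset.mem_univ t)⟩

theorem IsRainbow.three_mul_coverNum_le {E : Finset (Finset α)} {S : Fin 3 → Finset α}
    (hS : IsRainbow E S) : 3 * coverNum E ≤ ∑ t, (S t).card := by
  have h := fun t => coverNum_le_card (hS.isVertexCover t)
  have h0 := h 0
  have h1 := h 1
  have h2 := h 2
  rw [Fin.sum_univ_three]
  omega

end

/-- A connected 3-uniform hypergraph with m edges satisfying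
τ(H) = (2m+1)/3 is a hypertree admitting a perfect matching. -/
theorem stmt3 (E : Finset (Finset V)) (h3 : Uniform3 E) (hconn : HConnected E)
    (htau : 3 * coverNum E = 2 * E.card + 1) :
    IsHypertree E ∧ HasPerfectMatching E := by
  have hE : E.Nonempty := by
    rw [Finset.nonempty_iff_ne_empty]
    rintro rfl
    rw [Finset.card_empty] at htau
    omega
  obtain hT | ⟨S, hS, hw⟩ := hconn.isSeparatedTree_or_light h3 hE
  · refine ⟨⟨hconn, hT.forest.not_hasCycle⟩, ?_⟩
    obtain ⟨M, S, hME, hM, hS, hSM⟩ := hT.forest.exists_matching_cover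
    have hcov : coverNum E ≤ S.card := coverNum_le_card hS
    obtain ⟨e, he⟩ := hE
    obtain ⟨w, hw⟩ : e.Nonempty := Finset.card_pos.1 (by rw [h3 e he]; omega)
    have huniv : E.sup id = Finset.univ :=
      Finset.eq_univ_iff_forall.2 (hconn.mem_sup (mem_sup_id_iff.2 ⟨e, he, hw⟩))
    have hbi : (M.biUnion id).card = 3 * M.card := by
      rw [Finset.card_biUnion fun a ha b hb hab => hM ha hb hab,
        Finset.sum_congr rfl fun a ha => show (id a).card = 3 from h3 a (hME ha),
        Finset.sum_const, smul_eq_mul, mul_comm]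
    have hle := hT.card_le
    rw [huniv] at hle
    have hall : M.biUnion id = Finset.univ :=
      Finset.eq_of_subset_of_card_le (Finset.subset_univ _) (by omega)
    refine ⟨M, ⟨hME, fun a ha b hb hab => hM ha hb hab⟩, fun x => ?_⟩
    simpa using Finset.eq_univ_iff_forall.1 hall x
  · have := hS.three_mul_coverNum_le
    omega
end
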